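/- arXiv:2411.17067 — 6 statements merged into one kernel-verified Lean document; each statement's English description precedes it below -/
import Mathlib

section
/- Let N ∈ ℕ and for i = 1,…,N let K_i : ℝ → ℝ be nonnegative integrable functions, w_i > 0 weights, and [a_i, b_i] ⊆ [0, ∞) intervals with K_i(t) = 0 for t ∉ [a_i, b_i] and b_i ≤ a_{i+1} for i = 1,…,N−1 (sorted, non-overlapping supports). Let σ = Σ_{i=1}^N w_i K_i, let c_1,…,c_N ∈ ℝ^3 and let c : ℝ → ℝ^3 be any function with c(t) = c_i for t ∈ [a_i, b_i]. Define the footprints ρ_i = ∫_ℝ w_i K_i(t) dt. Then the volume-rendering integral satisfies ∫_0^∞ c(t) σ(t) exp(−∫_0^t σ(s) ds) dt = Σ_{i=1}^N c_i (1 − exp(−ρ_i)) Π_{j=1}^{i−1} exp(−ρ_j). -/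
open MeasureTheory Finset

/-- Postcomposition with a map that is `1`-Lipschitz on the range preserves absolute continuity. -/
theorem AbsolutelyContinuousOnInterval.comp_of_dist_le {X Y : Type*} [PseudoMetricSpace X]
    [PseudoMetricSpace Y] {f : ℝ → X} {g : X → Y} {a b : ℝ}
    (hf : AbsolutelyContinuousOnInterval f a b)
    (hg : ∀ x ∈ Set.uIcc a b, ∀ y ∈ Set.uIcc a b, dist (g (f x)) (g (f y)) ≤ dist (f x) (f y)) :
    AbsolutelyContinuousOnInterval (fun x => g (f x)) a b := by
  rw [absolutelyContinuousOnInterval_iff] at hf ⊢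
  intro ε hε
  obtain ⟨δ, hδ, h⟩ := hf ε hε
  refine ⟨δ, hδ, fun E hE hEδ => lt_of_le_of_lt (Finset.sum_le_sum fun i hi => ?_) (h E hE hEδ)⟩
  exact hg _ (hE.1 i hi).1 _ (hE.1 i hi).2

theorem Real.dist_exp_neg_le {x y : ℝ} (hx : 0 ≤ x) (hy : 0 ≤ y) :
    dist (Real.exp (-x)) (Real.exp (-y)) ≤ dist x y := by
  wlog hxy : x ≤ y generalizing x y
  · rw [dist_comm, dist_comm x]
    exact this hy hx (le_of_not_ge hxy)
  have h1 : Real.exp (-y) ≤ Real.exp (-x) := Real.exp_le_exp.2 (neg_le_neg hxy)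
  have h2 : Real.exp (-x) ≤ 1 := Real.exp_le_one_iff.2 (neg_nonpos.2 hx)
  have h3 : Real.exp (-y) = Real.exp (-x) * Real.exp (-(y - x)) := by
    rw [← Real.exp_add]; ring_nf
  have h4 := Real.add_one_le_exp (-(y - x))
  rw [Real.dist_eq, Real.dist_eq, abs_of_nonneg (sub_nonneg.2 h1), abs_sub_comm,
    abs_of_nonneg (sub_nonneg.2 hxy), h3]
  nlinarith [Real.exp_pos (-x)]

section Transmittance

variable {f : ℝ → ℝ}

/-- The transmittance of a nonnegative integrable density satisfies the fundamental theorem of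
calculus. -/
theorem intervalIntegral_mul_exp_neg_integral (hf : Integrable f) (hf0 : ∀ t, 0 ≤ f t) {T : ℝ}
    (hT : 0 ≤ T) :
    ∫ t in (0 : ℝ)..T, f t * Real.exp (-(∫ s in (0 : ℝ)..t, f s)) =
      1 - Real.exp (-(∫ s in (0 : ℝ)..T, f s)) := by
  have hnn : ∀ x ∈ Set.uIcc 0 T, 0 ≤ ∫ s in (0 : ℝ)..x, f s := fun x hx =>
    intervalIntegral.integral_nonneg (Set.uIcc_of_le hT ▸ hx).1 fun u _ => hf0 u
  have hac : AbsolutelyContinuousOnInterval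
      (fun t => Real.exp (-(∫ s in (0 : ℝ)..t, f s))) 0 T :=
    (hf.intervalIntegrable.absolutelyContinuousOnInterval_intervalIntegral
      Set.left_mem_uIcc).comp_of_dist_le (g := fun x => Real.exp (-x))
      fun x hx y hy => Real.dist_exp_neg_le (hnn x hx) (hnn y hy)
  have hderiv : ∀ᵐ t, deriv (fun t => Real.exp (-(∫ s in (0 : ℝ)..t, f s))) t =
      -(f t * Real.exp (-(∫ s in (0 : ℝ)..t, f s))) := by
    filter_upwards [LocallyIntegrable.ae_hasDerivAt_integral hf.locallyIntegrable] with t ht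
    rw [((ht 0).fun_neg.exp).deriv]
    ring
  have h := hac.integral_deriv_eq_sub
  rw [intervalIntegral.integral_congr_ae (hderiv.mono fun t ht _ => ht),
    intervalIntegral.integral_neg] at h
  simp only [intervalIntegral.integral_same, neg_zero, Real.exp_zero] at h
  linarith

theorem integrableOn_mul_exp_neg_integral (hf : Integrable f) (hf0 : ∀ t, 0 ≤ f t) :
    IntegrableOn (fun t => f t * Real.exp (-(∫ s in (0 : ℝ)..t, f s))) (Set.Ioi 0) := by
  have hcont : Continuous fun t => Real.exp (-(∫ s in (0 : ℝ)..t, f s)) :=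
    Real.continuous_exp.comp
      (intervalIntegral.continuous_primitive (fun _ _ => hf.intervalIntegrable) 0).neg
  refine hf.integrableOn.mul_bdd (c := 1) hcont.aestronglyMeasurable ?_
  filter_upwards [ae_restrict_mem measurableSet_Ioi] with t ht
  rw [Real.norm_eq_abs, Real.abs_exp, Real.exp_le_one_iff, neg_nonpos]
  exact intervalIntegral.integral_nonneg (le_of_lt ht) fun u _ => hf0 u

theorem setIntegral_Ioi_mul_exp_neg_integral (hf : Integrable f) (hf0 : ∀ t, 0 ≤ f t) :
    ∫ t in Set.Ioi (0 : ℝ), f t * Real.exp (-(∫ s in (0 : ℝ)..t, f s)) =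
      1 - Real.exp (-(∫ s in Set.Ioi (0 : ℝ), f s)) := by
  have h1 := intervalIntegral_tendsto_integral_Ioi 0
    (integrableOn_mul_exp_neg_integral hf hf0) Filter.tendsto_id
  have h2 := intervalIntegral_tendsto_integral_Ioi 0 hf.integrableOn Filter.tendsto_id
  refine tendsto_nhds_unique h1
    (((Real.continuous_exp.tendsto _).comp h2.neg).const_sub 1 |>.congr' ?_)
  filter_upwards [Filter.eventually_ge_atTop 0] with T hT
  exact (intervalIntegral_mul_exp_neg_integral hf hf0 hT).symm

variable {a b t : ℝ}

theorem setIntegral_Ioi_eq_integral_of_support_subset_Icc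
    (hsupp : ∀ t, t ∉ Set.Icc a b → f t = 0) (ha : 0 ≤ a) :
    ∫ s in Set.Ioi (0 : ℝ), f s = ∫ s, f s := by
  rw [← integral_Ici_eq_integral_Ioi]
  exact setIntegral_eq_integral_of_forall_compl_eq_zero fun x hx =>
    hsupp x fun h => hx (ha.trans h.1)

theorem intervalIntegral_eq_integral_of_support_subset_Icc
    (hsupp : ∀ t, t ∉ Set.Icc a b → f t = 0) (ha : 0 ≤ a) (ht0 : 0 ≤ t) (ht : b ≤ t) :
    ∫ s in (0 : ℝ)..t, f s = ∫ s, f s := by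
  rw [intervalIntegral.integral_of_le ht0, ← integral_Icc_eq_integral_Ioc]
  exact setIntegral_eq_integral_of_forall_compl_eq_zero fun x hx =>
    hsupp x fun h => hx ⟨ha.trans h.1, h.2.trans ht⟩

theorem intervalIntegral_eq_zero_of_support_subset_Icc
    (hsupp : ∀ t, t ∉ Set.Icc a b → f t = 0) (ht0 : 0 ≤ t) (ht : t ≤ a) :
    ∫ s in (0 : ℝ)..t, f s = 0 := by
  rw [intervalIntegral.integral_of_le ht0, integral_Ioc_eq_integral_Ioo]
  exact setIntegral_eq_zero_of_forall_eq_zero fun x hx =>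
    hsupp x fun h => absurd (h.1.trans_lt hx.2) ht.not_gt

end Transmittance

theorem Fin.endpoint_le_of_lt {N : ℕ} {a b : Fin N → ℝ} (hab : ∀ i, a i ≤ b i)
    (hsorted : ∀ i : Fin N, ∀ h : i.val + 1 < N, b i ≤ a ⟨i.val + 1, h⟩) {i j : Fin N}
    (hij : i < j) : b i ≤ a j := by
  obtain ⟨j, hj⟩ := j
  induction j with
  | zero => exact absurd hij (Nat.not_lt_zero _)
  | succ k ih =>
    have hk : k < N := Nat.lt_of_succ_lt hj
    rcases (Nat.lt_succ_iff.1 hij).lt_or_eq with h | h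
    · exact ((ih hk h).trans (hab _)).trans (hsorted ⟨k, hk⟩ hj)
    · obtain rfl : i = ⟨k, hk⟩ := Fin.ext h
      exact hsorted _ hj

/-- On the `i`-th support, the optical depth is the sum of the previous footprints and the optical
depth of the `i`-th kernel. -/
theorem intervalIntegral_sum_eq_of_mem_Icc {N : ℕ} {f : Fin N → ℝ → ℝ} {a b : Fin N → ℝ}
    (hf : ∀ i, Integrable (f i)) (ha : ∀ i, 0 ≤ a i)
    (hsupp : ∀ i t, t ∉ Set.Icc (a i) (b i) → f i t = 0)
    (hlt : ∀ i j, i < j → b i ≤ a j) {i : Fin N} {t : ℝ} (ht : t ∈ Set.Icc (a i) (b i)) :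
    ∫ s in (0 : ℝ)..t, ∑ j, f j s =
      (∑ j ∈ Finset.Iio i, ∫ s, f j s) + ∫ s in (0 : ℝ)..t, f i s := by
  have ht0 : 0 ≤ t := (ha i).trans ht.1
  rw [intervalIntegral.integral_finsetSum fun j _ => (hf j).intervalIntegrable,
    ← Finset.sum_subset (Finset.subset_univ (Finset.Iic i)) fun j _ hj => ?_,
    ← Finset.Iio_insert, Finset.sum_insert (by simp), add_comm]
  · refine congrArg (· + _) (Finset.sum_congr rfl fun j hj => ?_)
    exact intervalIntegral_eq_integral_of_support_subset_Icc (hsupp j) (ha j) ht0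
      ((hlt j i (Finset.mem_Iio.1 hj)).trans ht.1)
  · rw [Finset.mem_Iic, not_le] at hj
    exact intervalIntegral_eq_zero_of_support_subset_Icc (hsupp j) ht0 (ht.2.trans (hlt i j hj))

/-- The refined volume splatting formula: for a density field decomposed into `N`
nonnegative integrable kernels with sorted, non-overlapping supports
`[a i, b i] ⊆ [0, ∞)` along the ray, and a color function that is constant equal to
`c i` on the support of the `i`-th kernel, the volume rendering integral equals the
alpha-composited sum `Σ_i c_i (1 − exp(−ρ_i)) Π_{j<i} exp(−ρ_j)` where
`ρ_i = ∫ w_i K_i` is the exact footprint of the `i`-th kernel. -/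
theorem refined_volume_splatting (N : ℕ) (K : Fin N → ℝ → ℝ) (w : Fin N → ℝ)
    (a b : Fin N → ℝ)
    (c : Fin N → EuclideanSpace ℝ (Fin 3)) (cfun : ℝ → EuclideanSpace ℝ (Fin 3))
    (hK0 : ∀ i t, 0 ≤ K i t)
    (hKint : ∀ i, Integrable (K i))
    (hw : ∀ i, 0 < w i)
    (ha : ∀ i, 0 ≤ a i) (hab : ∀ i, a i ≤ b i)
    (hsupp : ∀ i t, t ∉ Set.Icc (a i) (b i) → K i t = 0)
    (hsorted : ∀ i : Fin N, ∀ h : i.val + 1 < N, b i ≤ a ⟨i.val + 1, h⟩)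
    (hcfun : ∀ i, ∀ t ∈ Set.Icc (a i) (b i), cfun t = c i) :
    (∫ t in Set.Ioi (0 : ℝ),
        ((∑ i, w i * K i t) * Real.exp (-(∫ s in (0 : ℝ)..t, ∑ i, w i * K i s))) • cfun t) =
      ∑ i, ((1 - Real.exp (-(∫ t, w i * K i t))) *
        ∏ j ∈ Finset.Iio i, Real.exp (-(∫ t, w j * K j t))) • c i := by
  have hf : ∀ i, Integrable fun t => w i * K i t := fun i => (hKint i).const_mul _
  have hf0 : ∀ i t, 0 ≤ w i * K i t := fun i t => mul_nonneg (hw i).le (hK0 i t)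
  have hfsupp : ∀ i t, t ∉ Set.Icc (a i) (b i) → w i * K i t = 0 := fun i t ht => by
    rw [hsupp i t ht, mul_zero]
  have hpt : ∀ t, ((∑ i, w i * K i t) *
      Real.exp (-(∫ s in (0 : ℝ)..t, ∑ i, w i * K i s))) • cfun t =
      ∑ i, (w i * K i t * Real.exp (-(∫ s in (0 : ℝ)..t, w i * K i s))) •
        ((∏ j ∈ Finset.Iio i, Real.exp (-(∫ t, w j * K j t))) • c i) := by
    intro t
    rw [Finset.sum_mul, Finset.sum_smul]
    refine Finset.sum_congr rfl fun i _ => ?_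
    by_cases ht : t ∈ Set.Icc (a i) (b i)
    · rw [intervalIntegral_sum_eq_of_mem_Icc hf ha hfsupp
        (fun _ _ => Fin.endpoint_le_of_lt hab hsorted) ht, hcfun i t ht, neg_add, Real.exp_add,
        ← Finset.sum_neg_distrib, Real.exp_sum, smul_smul]
      ring_nf
    · simp [hsupp i t ht]
  simp_rw [hpt]
  rw [integral_finsetSum _ fun i _ =>
    (integrableOn_mul_exp_neg_integral (hf i) (hf0 i)).smul_const _]
  refine Finset.sum_congr rfl fun i _ => ?_
  rw [integral_smul_const, setIntegral_Ioi_mul_exp_neg_integral (hf i) (hf0 i),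
    setIntegral_Ioi_eq_integral_of_support_subset_Icc (hfsupp i) (ha i), smul_smul]
end

section
/- Let ρ_1,…,ρ_N ∈ ℝ be footprints and c_1,…,c_N ∈ ℝ^3 colors, let 1 ≤ k and m ≥ 1 with k + m − 1 ≤ N, and suppose c_k = c_{k+1} = … = c_{k+m−1}. Let (ρ′, c′) be the sequence of length N−m+1 obtained by replacing the m consecutive entries (ρ_k, c_k),…,(ρ_{k+m−1}, c_{k+m−1}) with the single merged entry (ρ_k + … + ρ_{k+m−1}, c_k). Then C(ρ, c) = C(ρ′, c′); in particular Σ_{l=1}^{m} (1 − exp(−ρ_{k+l−1})) Π_{r=1}^{l−1} exp(−ρ_{k+r−1}) = 1 − exp(−Σ_{l=1}^{m} ρ_{k+l−1}). -/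
open Finset

/-- The alpha-composited (rendered) color of footprints `ρ` and colors `c`:
`C(ρ, c) = Σ_i c_i (1 − exp(−ρ_i)) Π_{j<i} exp(−ρ_j)`. -/
noncomputable def renderedColor {N : ℕ} (ρ : Fin N → ℝ)
    (c : Fin N → EuclideanSpace ℝ (Fin 3)) : EuclideanSpace ℝ (Fin 3) :=
  ∑ i, ((1 - Real.exp (-ρ i)) * ∏ j ∈ Finset.Iio i, Real.exp (-ρ j)) • c i

lemma prod_Iio_fin_val {M : Type*} [CommMonoid M] {n : ℕ} (f : ℕ → M) (i : Fin n) :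
    ∏ j ∈ Finset.Iio i, f j = ∏ j ∈ range i, f j := by
  rw [← Nat.Iio_eq_range, ← Fin.map_valEmbedding_Iio, Finset.prod_map]
  rfl

lemma exists_nat_extension {α : Type*} [Inhabited α] {n : ℕ} (f : Fin n → α) :
    ∃ g : ℕ → α, f = fun i : Fin n => g i :=
  ⟨fun i => if h : i < n then f ⟨i, h⟩ else default, by ext1 i; simp⟩

/-- Alpha compositing of the first `n` terms of sequences of footprints and colors. -/
noncomputable def composite {E : Type*} [AddCommGroup E] [Module ℝ E]
    (n : ℕ) (ρ : ℕ → ℝ) (c : ℕ → E) : E :=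
  ∑ i ∈ range n, ((1 - Real.exp (-ρ i)) * ∏ j ∈ range i, Real.exp (-ρ j)) • c i

lemma renderedColor_eq_composite {N : ℕ} (ρ : ℕ → ℝ) (c : ℕ → EuclideanSpace ℝ (Fin 3)) :
    renderedColor (fun i : Fin N => ρ i) (fun i => c i) = composite N ρ c := by
  unfold renderedColor composite
  rw [Finset.sum_range]
  refine Finset.sum_congr rfl fun i _ => ?_
  rw [prod_Iio_fin_val fun j => Real.exp (-ρ j)]

section

variable {E : Type*} [AddCommGroup E] [Module ℝ E]

lemma composite_congr {n : ℕ} {ρ ρ' : ℕ → ℝ} {c c' : ℕ → E}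
    (hρ : ∀ i < n, ρ i = ρ' i) (hc : ∀ i < n, c i = c' i) :
    composite n ρ c = composite n ρ' c' := by
  refine Finset.sum_congr rfl fun i hi => ?_
  have hi := Finset.mem_range.mp hi
  rw [hρ i hi, hc i hi, Finset.prod_congr rfl fun j hj => ?_]
  rw [hρ j ((Finset.mem_range.mp hj).trans hi)]

/-- Compositing front to back: the back layers are attenuated by the front transmittance. -/
lemma composite_add (a b : ℕ) (ρ : ℕ → ℝ) (c : ℕ → E) :
    composite (a + b) ρ c = composite a ρ c +
      Real.exp (-∑ j ∈ range a, ρ j) •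
        composite b (fun i => ρ (a + i)) (fun i => c (a + i)) := by
  unfold composite
  rw [Finset.sum_range_add, Finset.smul_sum]
  congr 1
  refine Finset.sum_congr rfl fun i _ => ?_
  rw [Finset.prod_range_add, ← Real.exp_sum, Finset.sum_neg_distrib, smul_smul]
  congr 1
  ring

lemma sum_opacity_mul_transmittance (n : ℕ) (ρ : ℕ → ℝ) :
    ∑ i ∈ range n, (1 - Real.exp (-ρ i)) * ∏ j ∈ range i, Real.exp (-ρ j) =
      1 - Real.exp (-∑ i ∈ range n, ρ i) := by
  rw [← Finset.sum_neg_distrib, Real.exp_sum]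
  induction n with
  | zero => simp
  | succ n ih => rw [Finset.sum_range_succ, Finset.prod_range_succ, ih]; ring

lemma composite_const (n : ℕ) (ρ : ℕ → ℝ) (c : E) :
    composite n ρ (fun _ => c) = (1 - Real.exp (-∑ i ∈ range n, ρ i)) • c := by
  rw [composite, ← Finset.sum_smul, sum_opacity_mul_transmittance]

/-- Replacing the block `k, …, k + m - 1` of constant color by one merged entry. -/
lemma composite_merge (k m n : ℕ) (hm : 1 ≤ m) (ρ : ℕ → ℝ) (c : ℕ → E)
    (hc : ∀ l < m, c (k + l) = c k) :
    composite (k + m + n) ρ c = composite (k + 1 + n)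
      (fun i => if i < k then ρ i else if i = k then ∑ l ∈ range m, ρ (k + l)
        else ρ (i + m - 1))
      (fun i => if i < k then c i else if i = k then c k else c (i + m - 1)) := by
  have hfront : ∑ j ∈ range k, (if j < k then ρ j else if j = k then
      ∑ l ∈ range m, ρ (k + l) else ρ (j + m - 1)) = ∑ j ∈ range k, ρ j :=
    Finset.sum_congr rfl fun j hj => if_pos (Finset.mem_range.mp hj)
  have hshift (i : ℕ) : k + 1 + i + m - 1 = k + m + i := by omega
  have hlt (i : ℕ) : ¬ k + 1 + i < k := by omega
  have hne (i : ℕ) : k + 1 + i ≠ k := by omega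
  rw [composite_add (k + m), composite_add k, composite_add (k + 1), composite_add k 1,
    Finset.sum_range_succ _ k, hfront, Finset.sum_range_add]
  simp only [hlt, hne, hshift, if_false, lt_irrefl, if_true]
  congr 2
  · exact composite_congr (fun i hi => (if_pos hi).symm) (fun i hi => (if_pos hi).symm)
  · rw [composite_congr (fun _ _ => rfl) hc, composite_const]
    simp [composite]

end

/-- Lemma 1: if `m` consecutive kernels (indices `k, …, k+m−1`) have the same color,
merging them into a single kernel with footprint `ρ_k + … + ρ_{k+m−1}` leaves the
rendered color unchanged; in particular
`Σ_{l<m} (1 − e^{−ρ_{k+l}}) Π_{r<l} e^{−ρ_{k+r}} = 1 − e^{−Σ_{l<m} ρ_{k+l}}`. -/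
theorem merge_m_fully_overlapping_kernels {N : ℕ} (ρ : Fin N → ℝ)
    (c : Fin N → EuclideanSpace ℝ (Fin 3)) (k m : ℕ) (hm : 1 ≤ m)
    (hkm : k + m ≤ N)
    (hc : ∀ l : Fin m, c ⟨k + l.val, by have := l.isLt; omega⟩ = c ⟨k, by omega⟩) :
    renderedColor ρ c =
      renderedColor (N := N - m + 1)
        (fun i => if i.val < k then ρ ⟨i.val, by have := i.isLt; omega⟩
          else if i.val = k then ∑ l : Fin m, ρ ⟨k + l.val, by have := l.isLt; omega⟩
          else ρ ⟨i.val + m - 1, by have := i.isLt; omega⟩)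
        (fun i => if i.val < k then c ⟨i.val, by have := i.isLt; omega⟩
          else if i.val = k then c ⟨k, by omega⟩
          else c ⟨i.val + m - 1, by have := i.isLt; omega⟩) ∧
    (∑ l : Fin m, (1 - Real.exp (-ρ ⟨k + l.val, by have := l.isLt; omega⟩)) *
        ∏ r ∈ Finset.Iio l, Real.exp (-ρ ⟨k + r.val, by have := r.isLt; omega⟩)) =
      1 - Real.exp (-(∑ l : Fin m, ρ ⟨k + l.val, by have := l.isLt; omega⟩)) := by
  obtain ⟨R, rfl⟩ := exists_nat_extension ρ
  obtain ⟨C, rfl⟩ := exists_nat_extension c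
  obtain ⟨n, rfl⟩ := Nat.exists_eq_add_of_le hkm
  refine ⟨?_, ?_⟩
  · have hlen : k + m + n - m + 1 = k + 1 + n := by omega
    have hsum : ∑ l : Fin m, R (k + l) = ∑ l ∈ range m, R (k + l) :=
      (Finset.sum_range fun l => R (k + l)).symm
    rw [renderedColor_eq_composite, composite_merge k m n hm R C fun l hl => hc ⟨l, hl⟩,
      ← hlen, ← renderedColor_eq_composite, ← hsum]
  · have h := sum_opacity_mul_transmittance m fun l => R (k + l)
    rw [Finset.sum_range, Finset.sum_range] at h
    rw [← h]
    refine Finset.sum_congr rfl fun l _ => ?_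
    rw [← prod_Iio_fin_val fun r => Real.exp (-R (k + r))]
end

section
/- Fix real numbers f > 0, h > 0, γ ∈ (0, 1], κ ∈ ℝ and t₀ ∈ ℝ. Define F : ℝ → ℝ by F(t) = f · (1 − |t − t₀| γ / h) − κ. Then ∫_{t₀ − h/γ}^{t₀ + h/γ} (ψ(−F(t)) / Ψ(−F(t))) · (f/h) · γ dt = 2 (ln Ψ(κ) − ln Ψ(κ − f)). -/
open MeasureTheory

/-- The probability density function of the standard normal distribution. -/
noncomputable def stdNormalPDF (x : ℝ) : ℝ :=
  Real.exp (-x ^ 2 / 2) / Real.sqrt (2 * Real.pi)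

/-- The cumulative distribution function of the standard normal distribution. -/
noncomputable def stdNormalCDF (x : ℝ) : ℝ :=
  ∫ u in Set.Iic x, stdNormalPDF u

theorem stdNormalPDF_pos (x : ℝ) : 0 < stdNormalPDF x := by
  unfold stdNormalPDF
  positivity

theorem continuous_stdNormalPDF : Continuous stdNormalPDF := by
  unfold stdNormalPDF
  fun_prop

theorem integrable_stdNormalPDF : Integrable stdNormalPDF := by
  have h := (integrable_exp_neg_mul_sq (b := 1 / 2) (by norm_num)).div_const
    (Real.sqrt (2 * Real.pi))
  refine h.congr (Filter.Eventually.of_forall fun x => ?_)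
  simp only [stdNormalPDF]
  ring_nf

theorem stdNormalCDF_pos (x : ℝ) : 0 < stdNormalCDF x := by
  unfold stdNormalCDF
  rw [setIntegral_pos_iff_support_of_nonneg_ae
    (Filter.Eventually.of_forall fun u => (stdNormalPDF_pos u).le)
    integrable_stdNormalPDF.integrableOn]
  have hs : Function.support stdNormalPDF = Set.univ :=
    Set.eq_univ_of_forall fun u => (stdNormalPDF_pos u).ne'
  simp [hs]

theorem hasDerivAt_stdNormalCDF (x : ℝ) : HasDerivAt stdNormalCDF (stdNormalPDF x) x := by
  have h : stdNormalCDF = fun y => stdNormalCDF 0 + ∫ u in (0 : ℝ)..y, stdNormalPDF u := by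
    funext y
    have := intervalIntegral.integral_Iic_sub_Iic (μ := volume) (a := 0) (b := y)
      integrable_stdNormalPDF.integrableOn integrable_stdNormalPDF.integrableOn
    simp only [stdNormalCDF]
    linarith
  rw [h]
  exact (intervalIntegral.integral_hasDerivAt_right
    (continuous_stdNormalPDF.intervalIntegrable 0 x)
    continuous_stdNormalPDF.stronglyMeasurable.stronglyMeasurableAtFilter
    continuous_stdNormalPDF.continuousAt).const_add _

theorem continuous_stdNormalCDF : Continuous stdNormalCDF :=
  continuous_iff_continuousAt.2 fun x => (hasDerivAt_stdNormalCDF x).continuousAt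

theorem continuous_stdNormalPDF_div_stdNormalCDF :
    Continuous fun x => stdNormalPDF x / stdNormalCDF x :=
  continuous_stdNormalPDF.div continuous_stdNormalCDF fun x => (stdNormalCDF_pos x).ne'

theorem integral_stdNormalPDF_div_stdNormalCDF_comp_affine (c m a b : ℝ) :
    ∫ t in a..b, stdNormalPDF (c + m * t) / stdNormalCDF (c + m * t) * m =
      Real.log (stdNormalCDF (c + m * b)) - Real.log (stdNormalCDF (c + m * a)) := by
  refine intervalIntegral.integral_eq_sub_of_hasDerivAt
    (f := fun t => Real.log (stdNormalCDF (c + m * t))) (fun t _ => ?_) ?_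
  · have hg : HasDerivAt (fun t => c + m * t) m t := by
      simpa using ((hasDerivAt_id t).const_mul m).const_add c
    have hΨ := (hasDerivAt_stdNormalCDF (c + m * t)).comp t hg
    exact (hΨ.log (stdNormalCDF_pos (c + m * t)).ne').congr_deriv
      (by simp only [Function.comp_apply]; ring)
  · exact ((continuous_stdNormalPDF_div_stdNormalCDF.comp
      (by fun_prop : Continuous fun t => c + m * t)).mul_const m).intervalIntegrable a b

/-- The closed form of the footprint of a linearly extruded Gaussian surfel:
for `F(t) = f·(1 − |t − t₀| γ / h) − κ`,
`∫_{t₀−h/γ}^{t₀+h/γ} (ψ(−F)/Ψ(−F)) · (f/h) · γ dt = 2 (ln Ψ(κ) − ln Ψ(κ − f))`,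
independently of the extrusion width `h`. -/
theorem surfel_footprint_closed_form (f h γ κ t₀ : ℝ)
    (hf : 0 < f) (hh : 0 < h) (hγ0 : 0 < γ) (hγ1 : γ ≤ 1)
    (F : ℝ → ℝ) (hF : ∀ t, F t = f * (1 - |t - t₀| * γ / h) - κ) :
    ∫ t in (t₀ - h / γ)..(t₀ + h / γ),
        stdNormalPDF (-F t) / stdNormalCDF (-F t) * (f / h) * γ =
      2 * (Real.log (stdNormalCDF κ) - Real.log (stdNormalCDF (κ - f))) := by
  have hcF : Continuous F := by
    rw [funext hF]
    fun_prop
  have hint : ∀ a b : ℝ, IntervalIntegrable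
      (fun t => stdNormalPDF (-F t) / stdNormalCDF (-F t) * (f / h) * γ) volume a b := fun a b =>
    (((continuous_stdNormalPDF_div_stdNormalCDF.comp hcF.neg).mul_const _).mul_const
      _).intervalIntegrable a b
  have hw : 0 < h / γ := div_pos hh hγ0
  rw [← intervalIntegral.integral_add_adjacent_intervals (hint _ t₀) (hint _ _)]
  have hright : ∫ t in t₀..(t₀ + h / γ),
      stdNormalPDF (-F t) / stdNormalCDF (-F t) * (f / h) * γ =
        Real.log (stdNormalCDF κ) - Real.log (stdNormalCDF (κ - f)) := by
    have key := integral_stdNormalPDF_div_stdNormalCDF_comp_affine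
      (κ - f - f * γ / h * t₀) (f * γ / h) t₀ (t₀ + h / γ)
    rw [show κ - f - f * γ / h * t₀ + f * γ / h * (t₀ + h / γ) = κ by field_simp; ring,
      show κ - f - f * γ / h * t₀ + f * γ / h * t₀ = κ - f by ring] at key
    rw [← key]
    refine intervalIntegral.integral_congr fun t ht => ?_
    rw [Set.uIcc_of_le (by linarith)] at ht
    have hFt : -F t = κ - f - f * γ / h * t₀ + f * γ / h * t := by
      rw [hF, abs_of_nonneg (by linarith [ht.1])]
      ring
    simp only [hFt]
    ring
  have hleft : ∫ t in (t₀ - h / γ)..t₀,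
      stdNormalPDF (-F t) / stdNormalCDF (-F t) * (f / h) * γ =
        Real.log (stdNormalCDF κ) - Real.log (stdNormalCDF (κ - f)) := by
    have hsymm : ∀ t, F (2 * t₀ - t) = F t := fun t => by
      rw [hF, hF, show 2 * t₀ - t - t₀ = -(t - t₀) by ring, abs_neg]
    have key := intervalIntegral.integral_comp_sub_left (a := t₀) (b := t₀ + h / γ)
      (fun t => stdNormalPDF (-F t) / stdNormalCDF (-F t) * (f / h) * γ) (2 * t₀)
    simp only [hsymm] at key
    rw [show 2 * t₀ - (t₀ + h / γ) = t₀ - h / γ by ring,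
      show 2 * t₀ - t₀ = t₀ by ring] at key
    rw [← key, hright]
  rw [hleft, hright]
  ring
end

section
/- Let α_1,…,α_N ∈ ℝ and c_1,…,c_N ∈ ℝ^3, and suppose c_k = c_{k+1} for some 1 ≤ k < N. Then the alpha-composited sum Σ_{i=1}^N c_i α_i Π_{j=1}^{i−1} (1 − α_j) is unchanged when the entries (α_k, c_k) and (α_{k+1}, c_{k+1}) are swapped. -/
open Finset

/-- The alpha-composited sum of opacities `α` with colors `c`:
`Σ_i c_i α_i Π_{j<i} (1 − α_j)`. -/
noncomputable def alphaComposite {N : ℕ} (α : Fin N → ℝ)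
    (c : Fin N → EuclideanSpace ℝ (Fin 3)) : EuclideanSpace ℝ (Fin 3) :=
  ∑ i, (α i * ∏ j ∈ Finset.Iio i, (1 - α j)) • c i

/-- A product over an initial segment is unchanged by swapping two adjacent indices,
unless the segment separates them. -/
theorem prod_Iio_comp_swap_of_covBy {ι M : Type*} [LinearOrder ι] [LocallyFiniteOrderBot ι]
    [CommMonoid M] {a b i : ι} (hab : a ⋖ b) (hi : i ≠ b) (f : ι → M) :
    ∏ j ∈ Finset.Iio i, f (Equiv.swap a b j) = ∏ j ∈ Finset.Iio i, f j := by
  have hlt : a < i ↔ b < i :=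
    ⟨fun h => lt_of_le_of_ne (hab.ge_of_gt h) hi.symm, hab.lt.trans⟩
  refine Finset.prod_equiv (Equiv.swap a b) (fun j => ?_) fun _ _ => rfl
  simp only [Finset.mem_Iio, Equiv.swap_apply_def]
  split_ifs with h₁ h₂ <;> simp_all

/-- Swapping two adjacent entries carrying the same color leaves the alpha-composited
sum unchanged. -/
theorem alphaComposite_swap_adjacent_same_color {N : ℕ} (α : Fin N → ℝ)
    (c : Fin N → EuclideanSpace ℝ (Fin 3)) (k : ℕ) (hk : k + 1 < N)
    (hc : c ⟨k, by omega⟩ = c ⟨k + 1, hk⟩) :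
    alphaComposite α c =
      alphaComposite (α ∘ Equiv.swap ⟨k, by omega⟩ ⟨k + 1, hk⟩)
        (c ∘ Equiv.swap ⟨k, by omega⟩ ⟨k + 1, hk⟩) := by
  have hab : (⟨k, by omega⟩ : Fin N) ⋖ ⟨k + 1, hk⟩ := by simp
  generalize (⟨k, by omega⟩ : Fin N) = a at *
  generalize (⟨k + 1, hk⟩ : Fin N) = b at *
  have hne : a ≠ b := hab.lt.ne
  have hIio : Finset.Iio b = insert a (Finset.Iio a) := by
    ext j
    simp only [Finset.mem_Iio, Finset.mem_insert, hab.lt_iff_le_left, le_iff_eq_or_lt]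
  have hprod (i : Fin N) (hi : i ≠ b) := prod_Iio_comp_swap_of_covBy hab hi fun j => 1 - α j
  simp only [alphaComposite, Function.comp_apply]
  rw [← Finset.sum_sdiff (Finset.subset_univ {a, b}),
    ← Finset.sum_sdiff (Finset.subset_univ {a, b}), Finset.sum_pair hne, Finset.sum_pair hne]
  congr 1
  · refine Finset.sum_congr rfl fun i hi => ?_
    obtain ⟨hia, hib⟩ : i ≠ a ∧ i ≠ b := by simpa using hi
    rw [hprod i hib, Equiv.swap_apply_of_ne_of_ne hia hib]
  · simp only [hIio, Finset.prod_insert (Finset.notMem_Iio_self (b := a)), hprod a hne,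
      Equiv.swap_apply_left, Equiv.swap_apply_right, hc, ← add_smul]
    congr 1
    ring
end

section
/- Let t_1,…,t_N ∈ ℝ, α_1,…,α_N ∈ ℝ, and c_1,…,c_N ∈ ℝ^3 be such that c_i = c_j whenever t_i = t_j. Let σ and σ′ be two permutations of {1,…,N} that both sort the depths nondecreasingly, i.e. t_{σ(1)} ≤ t_{σ(2)} ≤ … ≤ t_{σ(N)} and t_{σ′(1)} ≤ t_{σ′(2)} ≤ … ≤ t_{σ′(N)}. Then Σ_{i=1}^N c_{σ(i)} α_{σ(i)} Π_{j=1}^{i−1} (1 − α_{σ(j)}) = Σ_{i=1}^N c_{σ′(i)} α_{σ′(i)} Π_{j=1}^{i−1} (1 − α_{σ′(j)}). -/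
open Finset

/-- For a monotone sequence of depths, the total compositing weight of the level `x` is the
transmittance of the shallower levels times the opacity of the level itself. -/
theorem sum_level_weight {ι : Type*} [Fintype ι] [LinearOrder ι] [LocallyFiniteOrderBot ι]
    {T R : Type*} [LinearOrder T] [CommRing R] (s : ι → T) (hs : Monotone s) (a : ι → R) (x : T) :
    ∑ i with s i = x, a i * ∏ j ∈ Finset.Iio i, (1 - a j) =
      (∏ j with s j < x, (1 - a j)) * (1 - ∏ j with s j = x, (1 - a j)) := by
  rw [Finset.prod_one_sub_ordered {j | s j = x}, sub_sub_cancel, Finset.mul_sum]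
  refine Finset.sum_congr rfl fun i hi => ?_
  have hix : s i = x := (Finset.mem_filter.mp hi).2
  have hunion : Finset.Iio i = ({j | s j < x} : Finset ι) ∪
      {j ∈ ({j | s j = x} : Finset ι) | j < i} := by
    ext j
    simp only [Finset.mem_Iio, Finset.mem_union, Finset.mem_filter, Finset.mem_univ, true_and]
    constructor
    · intro hj
      exact (hix ▸ hs hj.le).lt_or_eq.imp_right fun h => ⟨h, hj⟩
    · rintro (h | h)
      · exact hs.reflect_lt (hix ▸ h)
      · exact h.2
  have hdisj : Disjoint ({j | s j < x} : Finset ι)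
      {j ∈ ({j | s j = x} : Finset ι) | j < i} := by
    rw [Finset.disjoint_left]
    intro j hj hj'
    simp only [Finset.mem_filter, Finset.mem_univ, true_and] at hj hj'
    exact hj.ne hj'.1
  rw [hunion, Finset.prod_union hdisj]
  ring

/-- The composited sum along a sorting permutation, grouped by depth, in a form that does not
mention the permutation. -/
theorem alphaComposite_eq_sum_levels {ι T R M : Type*} [Fintype ι] [LinearOrder ι]
    [LocallyFiniteOrderBot ι] [LinearOrder T] [CommRing R] [AddCommGroup M] [Module R M]
    (t : ι → T) (α : ι → R) (g : T → M) (σ : Equiv.Perm ι) (hσ : Monotone fun i => t (σ i)) :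
    ∑ i, (α (σ i) * ∏ j ∈ Finset.Iio i, (1 - α (σ j))) • g (t (σ i)) =
      ∑ x ∈ Finset.univ.image t,
        ((∏ k with t k < x, (1 - α k)) * (1 - ∏ k with t k = x, (1 - α k))) • g x := by
  have hprod (p : T → Prop) [DecidablePred p] :
      ∏ j with p (t (σ j)), (1 - α (σ j)) = ∏ k with p (t k), (1 - α k) := by
    simp only [Finset.prod_filter]
    exact Equiv.prod_comp σ fun k => if p (t k) then 1 - α k else 1
  rw [← Finset.sum_fiberwise_of_maps_to (s := Finset.univ) (t := Finset.univ.image t)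
    (g := fun i => t (σ i)) fun i _ => Finset.mem_image_of_mem t (Finset.mem_univ (σ i))]
  refine Finset.sum_congr rfl fun x _ => ?_
  rw [← hprod (· < x), ← hprod (· = x),
    ← sum_level_weight (fun i => t (σ i)) hσ (fun i => α (σ i)), Finset.sum_smul]
  refine Finset.sum_congr rfl fun i hi => ?_
  rw [(Finset.mem_filter.mp hi).2]

/-- Well-definedness of per-ray sorting with ties: if kernels with equal depths carry
equal colors, then the alpha-composited sum is the same for any two permutations that
sort the depths nondecreasingly. -/
theorem alphaComposite_sort_well_defined {N : ℕ} (t α : Fin N → ℝ)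
    (c : Fin N → EuclideanSpace ℝ (Fin 3))
    (hc : ∀ i j, t i = t j → c i = c j)
    (σ σ' : Equiv.Perm (Fin N))
    (hσ : Monotone fun i => t (σ i)) (hσ' : Monotone fun i => t (σ' i)) :
    ∑ i, (α (σ i) * ∏ j ∈ Finset.Iio i, (1 - α (σ j))) • c (σ i) =
      ∑ i, (α (σ' i) * ∏ j ∈ Finset.Iio i, (1 - α (σ' j))) • c (σ' i) := by
  obtain ⟨g, hg⟩ : ∃ g : ℝ → EuclideanSpace ℝ (Fin 3), ∀ i, c i = g (t i) :=
    ⟨Function.extend t c 0, fun i =>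
      (Function.FactorsThrough.extend_apply (fun i j h => hc i j h) 0 i).symm⟩
  simp only [hg]
  rw [alphaComposite_eq_sum_levels t α g σ hσ, alphaComposite_eq_sum_levels t α g σ' hσ']
end

section
/- Let N ∈ ℕ and for i = 1,…,N let K_i : ℝ → ℝ be nonnegative integrable functions, w_i > 0 weights, c_i ∈ ℝ^3 colors, and [a_i, b_i] ⊆ [0, ∞) intervals with K_i(t) = 0 for t ∉ [a_i, b_i]. Assume: (i) for all i ≠ j, either b_i ≤ a_j, or b_j ≤ a_i, or a_i = a_j and b_i = b_j; (ii) whenever a_i = a_j and b_i = b_j with i ≠ j, the colors agree, c_i = c_j; (iii) the indices are ordered so that a_1 ≤ a_2 ≤ … ≤ a_N. Let σ = Σ_{i=1}^N w_i K_i, let c : ℝ → ℝ^3 be any function with c(t) = c_i for t ∈ [a_i, b_i] (consistent by (i)–(ii)), and let ρ_i = ∫_ℝ w_i K_i(t) dt. Then ∫_0^∞ c(t) σ(t) exp(−∫_0^t σ(s) ds) dt = Σ_{i=1}^N c_i (1 − exp(−ρ_i)) Π_{j=1}^{i−1} exp(−ρ_j). -/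
open MeasureTheory Finset

/-- Postcomposing an absolutely continuous function with a function that is Lipschitz on a set
containing its values gives an absolutely continuous function. -/
theorem LipschitzOnWith.comp_absolutelyContinuousOnInterval {X Y : Type*} [PseudoMetricSpace X]
    [PseudoMetricSpace Y] {g : X → Y} {f : ℝ → X} {s : Set X} {C : NNReal} {a b : ℝ}
    (hg : LipschitzOnWith C g s) (hf : AbsolutelyContinuousOnInterval f a b)
    (hs : Set.MapsTo f (Set.uIcc a b) s) :
    AbsolutelyContinuousOnInterval (fun x ↦ g (f x)) a b := by
  rw [absolutelyContinuousOnInterval_iff] at hf ⊢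
  intro ε hε
  obtain ⟨δ, hδ, h⟩ := hf (ε / (C + 1)) (by positivity)
  refine ⟨δ, hδ, fun E hE hEδ ↦ ?_⟩
  have hlt := h E hE hEδ
  rw [lt_div_iff₀ (by positivity)] at hlt
  refine lt_of_le_of_lt ?_ hlt
  rw [Finset.sum_mul]
  refine Finset.sum_le_sum fun i hi ↦ ?_
  have hmem := hE.1 i hi
  have hdist := hg.dist_le_mul _ (hs hmem.1) _ (hs hmem.2)
  nlinarith [dist_nonneg (x := f (E.2 i).1) (y := f (E.2 i).2)]

/-- The exponential of an absolutely continuous function is absolutely continuous. -/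
theorem AbsolutelyContinuousOnInterval.exp {f : ℝ → ℝ} {a b : ℝ}
    (hf : AbsolutelyContinuousOnInterval f a b) :
    AbsolutelyContinuousOnInterval (fun x ↦ Real.exp (f x)) a b := by
  obtain ⟨C, hC⟩ := hf.exists_bound
  obtain ⟨L, hL⟩ := (Real.contDiff_exp (n := 1)).contDiffOn.exists_lipschitzOnWith (by decide)
    (convex_Icc (-C) C) isCompact_Icc
  exact hL.comp_absolutelyContinuousOnInterval hf fun x hx ↦ abs_le.1 (hC x hx)

/-- The emission density `f(t) exp (-∫₀ᵗ f)` of a nonnegative integrable `f`. -/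
noncomputable def emissionDensity (f : ℝ → ℝ) (t : ℝ) : ℝ :=
  f t * Real.exp (-(∫ s in (0 : ℝ)..t, f s))

theorem integrableOn_emissionDensity {f : ℝ → ℝ} (hf : Integrable f) (hf0 : ∀ t, 0 ≤ f t) :
    IntegrableOn (emissionDensity f) (Set.Ioi 0) := by
  have hcont : Continuous fun t ↦ Real.exp (-(∫ s in (0 : ℝ)..t, f s)) :=
    Real.continuous_exp.comp (hf.continuous_primitive 0).neg
  refine Integrable.mul_bdd (c := 1) hf.integrableOn hcont.aestronglyMeasurable ?_
  refine (ae_restrict_mem measurableSet_Ioi).mono fun t ht ↦ ?_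
  rw [Real.norm_eq_abs, Real.abs_exp, Real.exp_le_one_iff, neg_nonpos]
  exact intervalIntegral.integral_nonneg (le_of_lt ht) fun s _ ↦ hf0 s

theorem intervalIntegral_emissionDensity {f : ℝ → ℝ} (hf : Integrable f) (T : ℝ) :
    ∫ t in (0 : ℝ)..T, emissionDensity f t = 1 - Real.exp (-(∫ s in (0 : ℝ)..T, f s)) := by
  have hac : AbsolutelyContinuousOnInterval
      (fun t ↦ Real.exp (-(∫ s in (0 : ℝ)..t, f s))) 0 T :=
    (hf.intervalIntegrable.absolutelyContinuousOnInterval_intervalIntegral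
      Set.left_mem_uIcc).fun_neg.exp
  have hftc := hac.integral_deriv_eq_sub
  have hderiv : ∫ t in (0 : ℝ)..T, deriv (fun t ↦ Real.exp (-(∫ s in (0 : ℝ)..t, f s))) t =
      ∫ t in (0 : ℝ)..T, -emissionDensity f t := by
    refine intervalIntegral.integral_congr_ae ?_
    filter_upwards [LocallyIntegrable.ae_hasDerivAt_integral hf.locallyIntegrable] with t ht _
    rw [(ht 0).fun_neg.exp.deriv, emissionDensity]
    ring
  rw [hderiv, intervalIntegral.integral_neg, intervalIntegral.integral_same] at hftc
  simp only [neg_zero, Real.exp_zero] at hftc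
  linarith

theorem setIntegral_Ioi_emissionDensity {f : ℝ → ℝ} (hf : Integrable f) (hf0 : ∀ t, 0 ≤ f t) :
    ∫ t in Set.Ioi (0 : ℝ), emissionDensity f t =
      1 - Real.exp (-(∫ t in Set.Ioi (0 : ℝ), f t)) := by
  have hleft := intervalIntegral_tendsto_integral_Ioi 0 (integrableOn_emissionDensity hf hf0)
    Filter.tendsto_id
  have hright := intervalIntegral_tendsto_integral_Ioi 0 hf.integrableOn Filter.tendsto_id
  refine tendsto_nhds_unique hleft ?_
  simp only [intervalIntegral_emissionDensity hf]
  exact tendsto_const_nhds.sub ((Real.continuous_exp.tendsto _).comp hright.neg)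

/-- Adding a kernel `k` supported in `[a, b]` to a density `f` that vanishes to the right of `b`
changes the emission density only inside `[a, b]`; if `a = b`, no condition on `f` is needed. -/
theorem emissionDensity_add_eq_of_notMem {f k : ℝ → ℝ} {a b t : ℝ} (hf : Integrable f)
    (hk : Integrable k) (hab : a ≤ b) (hksupp : ∀ s, s ∉ Set.Icc a b → k s = 0)
    (hfsupp : a < b → ∀ s, b < s → f s = 0) (ht0 : 0 < t) (ht : t ∉ Set.Icc a b) :
    emissionDensity (fun s ↦ f s + k s) t = emissionDensity f t := by
  have hkt := hksupp t ht
  simp only [emissionDensity, hkt, add_zero]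
  by_cases hzero : f t = 0
  · simp [hzero]
  have hkint : ∫ s in (0 : ℝ)..t, k s = 0 := by
    rcases hab.lt_or_eq with hlt | rfl
    · have hta : t < a := by
        by_contra! hat
        exact hzero (hfsupp hlt t (by_contra fun htb ↦ ht ⟨hat, not_lt.1 htb⟩))
      refine intervalIntegral.integral_zero_ae (Filter.Eventually.of_forall fun s hs ↦ ?_)
      rw [Set.uIoc_of_le ht0.le] at hs
      exact hksupp s fun hsI ↦ by linarith [hsI.1, hs.2]
    · refine intervalIntegral.integral_zero_ae ?_
      filter_upwards [compl_mem_ae_iff.2 (measure_singleton (μ := volume) a)] with s hs _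
      exact hksupp s (by simpa using hs)
  rw [intervalIntegral.integral_add hf.intervalIntegrable hk.intervalIntegrable, hkint, add_zero]

/-- Front-to-back compositing of finitely many kernels, sorted by left endpoint, whose supporting
intervals are pairwise non-overlapping or equal. -/
theorem integrableOn_and_setIntegral_emissionDensity_sum {ι E : Type*} [LinearOrder ι]
    [NormedAddCommGroup E] [NormedSpace ℝ E] [CompleteSpace E] (f : ι → ℝ → ℝ) (a b : ι → ℝ)
    (c : ι → E) (cfun : ℝ → E)
    (hf0 : ∀ i t, 0 ≤ f i t) (hf : ∀ i, Integrable (f i))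
    (ha : ∀ i, 0 ≤ a i) (hab : ∀ i, a i ≤ b i)
    (hsupp : ∀ i t, t ∉ Set.Icc (a i) (b i) → f i t = 0)
    (hoverlap : ∀ i j, i ≠ j → b i ≤ a j ∨ b j ≤ a i ∨ (a i = a j ∧ b i = b j))
    (hsorted : Monotone a) (hcfun : ∀ i, ∀ t ∈ Set.Icc (a i) (b i), cfun t = c i)
    (s : Finset ι) :
    IntegrableOn (fun t ↦ emissionDensity (fun u ↦ ∑ i ∈ s, f i u) t • cfun t) (Set.Ioi 0) ∧
    ∫ t in Set.Ioi (0 : ℝ), emissionDensity (fun u ↦ ∑ i ∈ s, f i u) t • cfun t =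
      ∑ i ∈ s, ((1 - Real.exp (-(∫ t, f i t))) *
        ∏ j ∈ s with j < i, Real.exp (-(∫ t, f j t))) • c i := by
  induction s using Finset.induction_on_max with
  | empty => simp [emissionDensity]
  | insert m s hm ih =>
    obtain ⟨ihint, iheq⟩ := ih
    have hms : m ∉ s := fun h ↦ lt_irrefl _ (hm m h)
    set g : ℝ → ℝ := fun u ↦ ∑ i ∈ s, f i u with hg
    have hgint : Integrable g := integrable_finsetSum _ fun i _ ↦ hf i
    have hg0 : ∀ t, 0 ≤ g t := fun t ↦ Finset.sum_nonneg fun i _ ↦ hf0 i t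
    have hinsert : (fun u ↦ ∑ i ∈ insert m s, f i u) = fun u ↦ g u + f m u := by
      funext u
      rw [Finset.sum_insert hms, add_comm]
    have hgsupp : a m < b m → ∀ t, b m < t → g t = 0 := by
      refine fun hlt t ht ↦ Finset.sum_eq_zero fun i hi ↦ hsupp i t fun htI ↦ ?_
      have hle := hsorted (hm i hi).le
      rcases hoverlap i m (hm i hi).ne with h | h | h <;> linarith [htI.1, htI.2]
    have hsumint : Integrable fun u ↦ g u + f m u := hgint.add (hf m)
    have hsum0 : ∀ t, 0 ≤ g t + f m t := fun t ↦ add_nonneg (hg0 t) (hf0 m t)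
    have hdiffint : IntegrableOn (fun t ↦ emissionDensity (fun u ↦ g u + f m u) t -
        emissionDensity g t) (Set.Ioi 0) :=
      (integrableOn_emissionDensity hsumint hsum0).sub (integrableOn_emissionDensity hgint hg0)
    have hsplit : Set.EqOn (fun t ↦ emissionDensity (fun u ↦ g u + f m u) t • cfun t)
        (fun t ↦ emissionDensity g t • cfun t + (emissionDensity (fun u ↦ g u + f m u) t -
          emissionDensity g t) • c m) (Set.Ioi 0) := by
      intro t ht
      by_cases htI : t ∈ Set.Icc (a m) (b m)
      · simp only [hcfun m t htI, ← add_smul, add_sub_cancel]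
      · simp only [emissionDensity_add_eq_of_notMem hgint (hf m) (hab m) (hsupp m) hgsupp
          ht htI, sub_self, zero_smul, add_zero]
    have hfull : ∀ i, ∫ t in Set.Ioi (0 : ℝ), f i t = ∫ t, f i t := by
      intro i
      rw [← integral_Ici_eq_integral_Ioi]
      exact setIntegral_eq_integral_of_forall_compl_eq_zero fun t ht ↦
        hsupp i t fun htI ↦ ht ((ha i).trans htI.1)
    have hgfull : ∫ t in Set.Ioi (0 : ℝ), g t = ∑ i ∈ s, ∫ t, f i t := by
      rw [hg, integral_finsetSum _ fun i _ ↦ (hf i).integrableOn]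
      exact Finset.sum_congr rfl fun i _ ↦ hfull i
    rw [hinsert]
    refine ⟨(ihint.add (hdiffint.smul_const (c m))).congr_fun hsplit.symm measurableSet_Ioi, ?_⟩
    rw [setIntegral_congr_fun measurableSet_Ioi hsplit,
      integral_add ihint (hdiffint.smul_const (c m)), iheq, integral_smul_const,
      integral_sub (integrableOn_emissionDensity hsumint hsum0)
        (integrableOn_emissionDensity hgint hg0),
      setIntegral_Ioi_emissionDensity hsumint hsum0, setIntegral_Ioi_emissionDensity hgint hg0,
      integral_add hgint.integrableOn (hf m).integrableOn, hgfull, hfull m,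
      Finset.sum_insert hms, add_comm]
    have hlast : (insert m s).filter (· < m) = s := by
      rw [Finset.filter_insert, if_neg (lt_irrefl m), Finset.filter_true_of_mem hm]
    congr 1
    · rw [hlast, ← Real.exp_sum, Finset.sum_neg_distrib, neg_add, Real.exp_add]
      congr 1
      ring
    · refine Finset.sum_congr rfl fun i hi ↦ ?_
      rw [Finset.filter_insert, if_neg (hm i hi).not_gt]

/-- Theorem 1: when the supports `[a i, b i] ⊆ [0, ∞)` of any two kernels along the ray
are either non-overlapping or fully overlapped — in which case the two kernels have
exactly the same color — the indices are sorted by left endpoint, and the footprints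
`ρ_i = ∫ w_i K_i` are computed exactly, the refined splatting sum gives an exact
evaluation of the volume rendering integral for the density `σ = Σ_i w_i K_i`. -/
theorem refined_splatting_exact (N : ℕ) (K : Fin N → ℝ → ℝ) (w : Fin N → ℝ)
    (a b : Fin N → ℝ)
    (c : Fin N → EuclideanSpace ℝ (Fin 3)) (cfun : ℝ → EuclideanSpace ℝ (Fin 3))
    (hK0 : ∀ i t, 0 ≤ K i t)
    (hKint : ∀ i, Integrable (K i))
    (hw : ∀ i, 0 < w i)
    (ha : ∀ i, 0 ≤ a i) (hab : ∀ i, a i ≤ b i)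
    (hsupp : ∀ i t, t ∉ Set.Icc (a i) (b i) → K i t = 0)
    (hoverlap : ∀ i j, i ≠ j →
      b i ≤ a j ∨ b j ≤ a i ∨ (a i = a j ∧ b i = b j))
    (hcolor : ∀ i j, i ≠ j → a i = a j → b i = b j → c i = c j)
    (hsorted : Monotone a)
    (hcfun : ∀ i, ∀ t ∈ Set.Icc (a i) (b i), cfun t = c i) :
    (∫ t in Set.Ioi (0 : ℝ),
        ((∑ i, w i * K i t) * Real.exp (-(∫ s in (0 : ℝ)..t, ∑ i, w i * K i s))) • cfun t) =
      ∑ i, ((1 - Real.exp (-(∫ t, w i * K i t))) *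
        ∏ j ∈ Finset.Iio i, Real.exp (-(∫ t, w j * K j t))) • c i := by
  have h := (integrableOn_and_setIntegral_emissionDensity_sum (fun i t ↦ w i * K i t) a b c
    cfun (fun i t ↦ mul_nonneg (hw i).le (hK0 i t)) (fun i ↦ (hKint i).const_mul (w i)) ha hab
    (fun i t ht ↦ by simp [hsupp i t ht]) hoverlap hsorted hcfun univ).2
  simpa only [emissionDensity, Finset.filter_gt_eq_Iio] using h
end
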